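/- (λ-lemma, general accumulation.) Let n ≥ 1 and let (A_m) be a sequence of 2×2 complex matrices with A_m = u_m·d_m·v_m, where u_m and v_m are unitary, d_m = diag(s_m, s_m^{−1}) with s_m ∈ ℝ, s_m ≥ 1, s_m → ∞, and u_m → u, v_m → v. Let z ∈ ℂ^{n+1} be nonzero, set w = ϱₙ(v)·z (which is nonzero), and let j be the least index with w_j ≠ 0. Then for every index k with j < k ≤ n, the ratio (ϱₙ(u_m)^{−1}·ϱₙ(A_m)·z)_k / (ϱₙ(u_m)^{−1}·ϱₙ(A_m)·z)_j tends to 0 as m → ∞. Consequently, every cluster point in ℂ^{n+1} of the normalized sequence ϱₙ(A_m)·z / ‖ϱₙ(A_m)·z‖ lies in the subspace ϱₙ(u)·span{e₀, e₁, …, e_j}. (The orbit of a point in F⁻_j ∖ F⁻_{j+1} accumulates on the flag subspace F⁺_j.) -/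

import Mathlib

open Matrix Filter Topology

/-- The Veronese lift `Ψₙ : ℂ² → ℂ^{n+1}`, whose `k`-th coordinate at `(x, y)` is
`C(n,k) · x^(n-k) · y^k`. -/
noncomputable def veronese (n : ℕ) (v : Fin 2 → ℂ) : Fin (n + 1) → ℂ :=
  fun k => (n.choose (k : ℕ) : ℂ) * v 0 ^ (n - (k : ℕ)) * v 1 ^ (k : ℕ)

/-- The matrix `ϱₙ(A)`: the n-th symmetric power of the 2×2 matrix `A` written in the
Veronese basis, given by the explicit entry formula. -/
noncomputable def rho (n : ℕ) (A : Matrix (Fin 2) (Fin 2) ℂ) :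
    Matrix (Fin (n + 1)) (Fin (n + 1)) ℂ :=
  fun m j =>
    ((n.choose (m : ℕ) : ℂ) / (n.choose (j : ℕ) : ℂ)) *
      ∑ l ∈ Finset.Icc ((j : ℕ) - (n - (m : ℕ))) (min (j : ℕ) (m : ℕ)),
        (((n - (m : ℕ)).choose ((j : ℕ) - l) : ℂ) * (((m : ℕ).choose l : ℕ) : ℂ)) *
          A 0 0 ^ (n - (m : ℕ) - ((j : ℕ) - l)) * A 0 1 ^ ((j : ℕ) - l) *
          A 1 0 ^ ((m : ℕ) - l) * A 1 1 ^ l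

/-- The standard Euclidean norm on `ℂ^{n+1}`. -/
noncomputable def euclNorm {n : ℕ} (x : Fin (n + 1) → ℂ) : ℝ :=
  Real.sqrt (∑ i, ‖x i‖ ^ 2)

/-- The matrix `rho n A` intertwines the Veronese lift with the action of `A`. -/
theorem rho_mulVec_veronese (n : ℕ) (A : Matrix (Fin 2) (Fin 2) ℂ) (v : Fin 2 → ℂ) :
    rho n A *ᵥ veronese n v = veronese n (A *ᵥ v) := by
  ext ⟨m, hm⟩
  simp only [mulVec, dotProduct, rho, veronese, Fin.sum_univ_two]
  rw [mul_assoc, add_comm (A 0 0 * v 0), add_comm (A 1 0 * v 0), add_pow, add_pow,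
    Finset.sum_mul_sum, Finset.sum_comm,
    Fin.sum_univ_eq_sum_range (fun j => (n.choose m : ℂ) / (n.choose j : ℂ) *
      (∑ l ∈ Finset.Icc (j - (n - m)) (min j m),
        (((n - m).choose (j - l) : ℂ) * ((m.choose l : ℕ) : ℂ)) *
          A 0 0 ^ (n - m - (j - l)) * A 0 1 ^ (j - l) * A 1 0 ^ (m - l) * A 1 1 ^ l) *
      ((n.choose j : ℂ) * v 0 ^ (n - j) * v 1 ^ j)) (n + 1)]
  simp only [Finset.mul_sum, Finset.sum_mul]
  rw [Finset.sum_comm' (t' := Finset.range (m + 1)) (s' := fun l => Finset.Icc l (l + (n - m)))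
    (by intro j l; simp only [Finset.mem_range, Finset.mem_Icc]; omega)]
  refine Finset.sum_congr rfl fun l hl => ?_
  rw [Finset.mem_range] at hl
  refine (Finset.sum_bij (fun i _ => l + i) ?_ ?_ ?_ ?_).symm
  · intro i hi
    simp only [Finset.mem_range, Finset.mem_Icc] at hi ⊢
    omega
  · intro i _ i' _ h
    omega
  · intro j hj
    rw [Finset.mem_Icc] at hj
    exact ⟨j - l, by rw [Finset.mem_range]; omega, by omega⟩
  · intro i hi
    rw [Finset.mem_range] at hi
    have hc : (n.choose (l + i) : ℂ) ≠ 0 := by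
      exact_mod_cast (Nat.choose_pos (by omega : l + i ≤ n)).ne'
    have hsub : n - (l + i) = (n - m - i) + (m - l) := by omega
    rw [Nat.add_sub_cancel_left, hsub]
    field_simp
    ring

/-- A matrix is determined by its action on the Veronese curve. -/
theorem matrix_ext_veronese {n : ℕ} {M N : Matrix (Fin (n + 1)) (Fin (n + 1)) ℂ}
    (h : ∀ v, M *ᵥ veronese n v = N *ᵥ veronese n v) : M = N := by
  ext i k
  let p : Polynomial ℂ :=
    ∑ l : Fin (n + 1), Polynomial.monomial (l : ℕ) ((M i l - N i l) * (n.choose l : ℂ))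
  have hp : p = 0 := by
    refine Polynomial.funext fun t => ?_
    have ht := congrFun (h ![1, t]) i
    simp only [mulVec, dotProduct, veronese, cons_val_zero, cons_val_one, one_pow, mul_one] at ht
    simp only [p, Polynomial.eval_finsetSum, Polynomial.eval_monomial, Polynomial.eval_zero]
    rw [← sub_eq_zero, ← Finset.sum_sub_distrib] at ht
    rw [← ht]
    exact Finset.sum_congr rfl fun l _ => by ring
  have hk := congrArg (fun q => Polynomial.coeff q (k : ℕ)) hp
  simp only [p, Polynomial.finsetSum_coeff, Polynomial.coeff_monomial, Fin.val_inj,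
    Finset.sum_ite_eq', Finset.mem_univ, if_true, Polynomial.coeff_zero] at hk
  have hc : (n.choose (k : ℕ) : ℂ) ≠ 0 := by
    exact_mod_cast (Nat.choose_pos (Nat.lt_succ_iff.mp k.isLt)).ne'
  exact sub_eq_zero.mp ((mul_eq_zero.mp hk).resolve_right hc)

theorem rho_mul (n : ℕ) (A B : Matrix (Fin 2) (Fin 2) ℂ) :
    rho n (A * B) = rho n A * rho n B :=
  matrix_ext_veronese fun v => by
    simp only [← mulVec_mulVec, rho_mulVec_veronese]

theorem rho_one (n : ℕ) : rho n 1 = 1 :=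
  matrix_ext_veronese fun v => by
    simp only [rho_mulVec_veronese, one_mulVec]

theorem rho_diagonal (n : ℕ) (a d : ℂ) :
    rho n (diagonal ![a, d]) = diagonal fun k : Fin (n + 1) => a ^ (n - (k : ℕ)) * d ^ (k : ℕ) :=
  matrix_ext_veronese fun v => by
    ext k
    rw [rho_mulVec_veronese, mulVec_diagonal]
    simp only [veronese, mulVec_diagonal, cons_val_zero, cons_val_one, mul_pow]
    ring

theorem continuous_rho (n : ℕ) : Continuous (rho n) := by
  refine continuous_matrix fun m j => ?_
  unfold rho
  fun_prop

/-- The inverse of `rho n U` for a matrix `U` with left inverse `Uᴴ`. -/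
theorem inv_rho_of_conjTranspose_mul_self {n : ℕ} {U : Matrix (Fin 2) (Fin 2) ℂ}
    (hU : Uᴴ * U = 1) : (rho n U)⁻¹ = rho n Uᴴ :=
  inv_eq_left_inv (by rw [← rho_mul, hU, rho_one])

/-- In the frame `rho n U`, the matrix `rho n (U * diag(a, d) * V)` scales the `k`-th coordinate
of `rho n V *ᵥ z` by `a ^ (n - k) * d ^ k`. -/
theorem inv_rho_mulVec_rho_apply {n : ℕ} {U : Matrix (Fin 2) (Fin 2) ℂ} (hU : Uᴴ * U = 1)
    (V : Matrix (Fin 2) (Fin 2) ℂ) (a d : ℂ) (z : Fin (n + 1) → ℂ) (k : Fin (n + 1)) :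
    ((rho n U)⁻¹ *ᵥ (rho n (U * diagonal ![a, d] * V) *ᵥ z)) k =
      a ^ (n - (k : ℕ)) * d ^ (k : ℕ) * (rho n V *ᵥ z) k := by
  rw [inv_rho_of_conjTranspose_mul_self hU, mulVec_mulVec, ← rho_mul, ← mul_assoc, ← mul_assoc,
    hU, one_mul, rho_mul, rho_diagonal, ← mulVec_mulVec, mulVec_diagonal]

/-- For `j < k`, the ratio of the `k`-th to the `j`-th diagonal entry of `rho n (diag(a, a⁻¹))`. -/
theorem diagonal_weight_div {n j k : ℕ} (hjk : j < k) (hkn : k ≤ n) {a : ℂ} (ha : a ≠ 0) :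
    a ^ (n - k) * a⁻¹ ^ k / (a ^ (n - j) * a⁻¹ ^ j) = a⁻¹ ^ (2 * (k - j)) := by
  obtain ⟨p, rfl⟩ := Nat.exists_eq_add_of_lt hjk
  obtain ⟨q, rfl⟩ := Nat.exists_eq_add_of_le hkn
  have h₁ : j + p + 1 + q - (j + p + 1) = q := by omega
  have h₂ : j + p + 1 + q - j = p + 1 + q := by omega
  have h₃ : j + p + 1 - j = p + 1 := by omega
  rw [h₁, h₂, h₃]
  simp only [inv_pow]
  field_simp
  ring

/-- λ-lemma (general accumulation): for a divergent sequence `A_m = u_m · diag(s_m, s_m⁻¹) · v_m`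
with `u_m, v_m` unitary converging to `u₀, v₀` and `s_m → ∞`, if `z ≠ 0` and `j` is the least
index with `(ϱₙ(v₀)·z)_j ≠ 0`, then the coordinates of `ϱₙ(u_m)⁻¹ · ϱₙ(A_m) · z` beyond the
`j`-th are negligible relative to the `j`-th, and every cluster point of the normalized orbit
`ϱₙ(A_m)·z / ‖ϱₙ(A_m)·z‖` lies in the flag subspace `ϱₙ(u₀) · span{e₀, …, e_j}`. -/
theorem lambda_lemma (n : ℕ) (hn : 1 ≤ n)
    (u v : ℕ → Matrix (Fin 2) (Fin 2) ℂ) (s : ℕ → ℝ)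
    (hu : ∀ m, (u m)ᴴ * u m = 1) (hv : ∀ m, (v m)ᴴ * v m = 1)
    (hs1 : ∀ m, 1 ≤ s m) (hs : Tendsto s atTop atTop)
    (A : ℕ → Matrix (Fin 2) (Fin 2) ℂ)
    (hA : ∀ m, A m = u m * Matrix.diagonal ![(s m : ℂ), (s m : ℂ)⁻¹] * v m)
    (u₀ v₀ : Matrix (Fin 2) (Fin 2) ℂ)
    (huc : Tendsto u atTop (𝓝 u₀)) (hvc : Tendsto v atTop (𝓝 v₀))
    (z : Fin (n + 1) → ℂ) (hz : z ≠ 0)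
    (j : Fin (n + 1))
    (hwj : (rho n v₀ *ᵥ z) j ≠ 0)
    (hmin : ∀ i : Fin (n + 1), i < j → (rho n v₀ *ᵥ z) i = 0) :
    (∀ k : Fin (n + 1), j < k →
      Tendsto (fun m =>
          ((rho n (u m))⁻¹ *ᵥ (rho n (A m) *ᵥ z)) k /
            ((rho n (u m))⁻¹ *ᵥ (rho n (A m) *ᵥ z)) j)
        atTop (𝓝 0)) ∧
    (∀ y : Fin (n + 1) → ℂ,
      MapClusterPt y atTop
        (fun m => (euclNorm (rho n (A m) *ᵥ z))⁻¹ • (rho n (A m) *ᵥ z)) →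
      y ∈ Submodule.span ℂ
        {x : Fin (n + 1) → ℂ |
          ∃ i : Fin (n + 1), i ≤ j ∧ x = rho n u₀ *ᵥ Pi.single i (1 : ℂ)}) := by
  have hs0 : ∀ m, (s m : ℂ) ≠ 0 := fun m => by
    exact_mod_cast (zero_lt_one.trans_le (hs1 m)).ne'
  have hw : ∀ k, Tendsto (fun m => (rho n (v m) *ᵥ z) k) atTop (𝓝 ((rho n v₀ *ᵥ z) k)) :=
    fun k => (((continuous_rho n).matrix_mulVec continuous_const).tendsto v₀ |>.comp hvc
      |>.apply_nhds k)
  have hsinv : Tendsto (fun m => (s m : ℂ)⁻¹) atTop (𝓝 0) := by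
    have h := (Complex.continuous_ofReal.tendsto 0).comp (tendsto_inv_atTop_zero.comp hs)
    simpa [Function.comp_def] using h
  have hratio : ∀ k : Fin (n + 1), j < k →
      Tendsto (fun m => ((rho n (u m))⁻¹ *ᵥ (rho n (A m) *ᵥ z)) k /
        ((rho n (u m))⁻¹ *ᵥ (rho n (A m) *ᵥ z)) j) atTop (𝓝 0) := by
    intro k hjk
    have hlim := (hsinv.pow (2 * ((k : ℕ) - j))).mul ((hw k).div (hw j) hwj)
    rw [zero_pow (by have : (j : ℕ) < k := hjk; omega), zero_mul] at hlim
    refine hlim.congr fun m => ?_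
    rw [hA, inv_rho_mulVec_rho_apply (hu m), inv_rho_mulVec_rho_apply (hu m), mul_div_mul_comm,
      diagonal_weight_div hjk (Nat.lt_succ_iff.mp k.isLt) (hs0 m)]
    rfl
  refine ⟨hratio, fun y hy => ?_⟩
  obtain ⟨F, hF, hFy⟩ := mapClusterPt_iff_ultrafilter.mp hy
  have hu₀ : u₀ᴴ * u₀ = 1 := by
    have h : Tendsto (fun m => (u m)ᴴ * u m) atTop (𝓝 (u₀ᴴ * u₀)) :=
      ((continuous_id.matrix_conjTranspose.matrix_mul continuous_id).tendsto u₀).comp huc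
    simp only [hu] at h
    exact tendsto_nhds_unique h tendsto_const_nhds
  have hinv : Tendsto (fun m => (rho n (u m))⁻¹) F (𝓝 (rho n u₀ᴴ)) := by
    simp only [inv_rho_of_conjTranspose_mul_self (hu _)]
    exact (((continuous_rho n).comp continuous_id.matrix_conjTranspose).tendsto u₀).comp
      (huc.mono_left hF)
  have hlim : ∀ k, Tendsto (fun m => ((rho n (u m))⁻¹ *ᵥ
      ((euclNorm (rho n (A m) *ᵥ z))⁻¹ • (rho n (A m) *ᵥ z))) k) F (𝓝 ((rho n u₀ᴴ *ᵥ y) k)) :=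
    fun k => ((continuous_fst.matrix_mulVec continuous_snd).tendsto (rho n u₀ᴴ, y)
      |>.comp (hinv.prodMk_nhds hFy)).apply_nhds k
  have hzero : ∀ k, j < k → (rho n u₀ᴴ *ᵥ y) k = 0 := by
    intro k hjk
    have hprod := ((hratio k hjk).mono_left hF).mul (hlim j)
    rw [zero_mul] at hprod
    refine tendsto_nhds_unique (hlim k) (hprod.congr' ?_)
    filter_upwards [hF ((hw j).eventually_ne hwj)] with m hm
    have hne : ((rho n (u m))⁻¹ *ᵥ (rho n (A m) *ᵥ z)) j ≠ 0 := by
      rw [hA, inv_rho_mulVec_rho_apply (hu m)]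
      exact mul_ne_zero (mul_ne_zero (pow_ne_zero _ (hs0 m))
        (pow_ne_zero _ (inv_ne_zero (hs0 m)))) hm
    simp only [mulVec_smul, Pi.smul_apply]
    rw [mul_smul_comm, div_mul_cancel₀ _ hne]
  have hy_eq : y = ∑ k, (rho n u₀ᴴ *ᵥ y) k • (rho n u₀ *ᵥ Pi.single k (1 : ℂ)) := by
    simp only [← mulVec_smul, ← mulVec_sum, ← Pi.single_smul, smul_eq_mul, mul_one,
      Finset.univ_sum_single]
    rw [mulVec_mulVec, ← rho_mul, mul_eq_one_comm.mp hu₀, rho_one, one_mulVec]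
  rw [hy_eq]
  refine Submodule.sum_mem _ fun k _ => ?_
  rcases le_or_gt k j with hkj | hjk
  · exact Submodule.smul_mem _ _ (Submodule.subset_span ⟨k, hkj, rfl⟩)
  · rw [hzero k hjk, zero_smul]
    exact Submodule.zero_mem _
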